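/- If X is a Polish space and F₀(X) is an F_σ subset of F(X) (for an admissible topology), then X is zero-dimensional, and hence F₀(X) = F(X). -/

import Mathlib

open Set Filter Topology TopologicalSpace

/-- `DimLE X n` : the topological (covering) dimension of `X` is at most `n`, i.e. every
finite open cover of `X` admits an open shrinking (refinement) of order at most `n + 1`. -/
def DimLE (X : Type*) [TopologicalSpace X] (n : ℕ) : Prop :=
  ∀ (k : ℕ) (U : Fin k → Set X), (∀ i, IsOpen (U i)) → (⋃ i, U i) = Set.univ →
    ∃ V : Fin k → Set X, (∀ i, IsOpen (V i)) ∧ (∀ i, V i ⊆ U i) ∧ (⋃ i, V i) = Set.univ ∧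
      ∀ x : X, ({i | x ∈ V i}).ncard ≤ n + 1

/-- The collection `F(X)` of closed subsets of `X`. -/
abbrev Cl (X : Type*) [TopologicalSpace X] : Type _ := {F : Set X // IsClosed F}

/-- `F₀(X)` : the set of all closed zero-dimensional subsets of `X`. -/
def F0 (X : Type*) [TopologicalSpace X] : Set (Cl X) := {F | DimLE (↥F.1) 0}

/-- The Vietoris topology on subsets of `Y`. -/
def vietoris (Y : Type*) [TopologicalSpace Y] : TopologicalSpace (Set Y) :=
  TopologicalSpace.generateFrom
    ({S | ∃ U : Set Y, IsOpen U ∧ S = {A : Set Y | A ⊆ U}} ∪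
     {S | ∃ U : Set Y, IsOpen U ∧ S = {A : Set Y | (A ∩ U).Nonempty}})

/-- A topology `τ` on `F(X)` is admissible if it is induced, via `F ↦ closure (e '' F)`,
by the Vietoris topology on some metrizable compactification `Y` of `X` (with embedding `e`). -/
def IsAdmissible (X : Type*) [tX : TopologicalSpace X] (τ : TopologicalSpace (Cl X)) : Prop :=
  ∃ (Y : Type) (tY : TopologicalSpace Y) (_ : @CompactSpace Y tY)
    (_ : @TopologicalSpace.MetrizableSpace Y tY) (e : X → Y),
      @Topology.IsEmbedding X Y tX tY e ∧
      τ = (@vietoris Y tY).induced (fun F : Cl X => @closure Y tY (e '' F.1))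

/-- An analytic space: a separable metrizable space which is empty or a continuous image
of the Baire space `ℕ → ℕ`. -/
def IsAnalyticSpace (X : Type*) [TopologicalSpace X] : Prop :=
  TopologicalSpace.MetrizableSpace X ∧ TopologicalSpace.SeparableSpace X ∧
    (IsEmpty X ∨ ∃ f : (ℕ → ℕ) → X, Continuous f ∧ Function.Surjective f)

/-- `Σ¹₂` subsets of a topological space: projections of co-analytic sets. -/
def IsSigma12 {W : Type*} [TopologicalSpace W] (s : Set W) : Prop :=
  ∃ B : Set (W × (ℕ → ℕ)), MeasureTheory.AnalyticSet Bᶜ ∧ s = {w | ∃ y, (w, y) ∈ B}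

/-- `Σ¹₂`-hardness (with Cantor space `2^ω = ℕ → Bool` as source). -/
def Sigma12Hard {W : Type*} [TopologicalSpace W] (A : Set W) : Prop :=
  ∀ A' : Set (ℕ → Bool), IsSigma12 A' →
    ∃ φ : (ℕ → Bool) → W, Continuous φ ∧ A' = φ ⁻¹' A

/-- `Π¹₁`-hardness. -/
def Pi11Hard {W : Type*} [TopologicalSpace W] (A : Set W) : Prop :=
  ∀ A' : Set (ℕ → Bool), MeasureTheory.AnalyticSet A'ᶜ →
    ∃ φ : (ℕ → Bool) → W, Continuous φ ∧ A' = φ ⁻¹' A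

/-- The additive Borel classes `Σ⁰ξ` : `Σ⁰₁` consists of the open sets, and for `ξ > 1`,
`Σ⁰ξ` consists of countable unions of sets whose complements are in some `Σ⁰η`, `η < ξ`. -/
inductive SigmaOrd {W : Type*} [TopologicalSpace W] : Ordinal.{0} → Set W → Prop
  | basic (s : Set W) : IsOpen s → SigmaOrd 1 s
  | union (ξ : Ordinal.{0}) (η : ℕ → Ordinal.{0}) (f : ℕ → Set W) (hξ : 1 < ξ)
      (hη : ∀ n, η n < ξ) (h : ∀ n, SigmaOrd (η n) (f n)ᶜ) : SigmaOrd ξ (⋃ n, f n)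

/-- The run produced when player I follows the strategy `σ` and player II plays `β`. -/
def playI (σ : List ℕ → ℕ) (β : ℕ → ℕ) : ℕ → ℕ := fun n =>
  if n % 2 = 0 then σ (List.ofFn fun i : Fin (n / 2) => β i) else β (n / 2)

/-- Player I has a winning strategy in the game `G_A`. -/
def PlayerIWins (A : Set (ℕ → ℕ)) : Prop :=
  ∃ σ : List ℕ → ℕ, ∀ β : ℕ → ℕ, playI σ β ∈ A

/-- The game operator `Game B` applied to `B ⊆ W × ω^ω`. -/
def GameOp {W : Type*} (B : Set (W × (ℕ → ℕ))) : Set W :=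
  {w | PlayerIWins {γ | (w, γ) ∈ B}}

/-- `Game Σ⁰ξ`-hardness. -/
def GameSigmaHard (ξ : Ordinal.{0}) {W : Type*} [TopologicalSpace W] (A : Set W) : Prop :=
  ∀ A' : Set (ℕ → Bool),
    (∃ B : Set ((ℕ → Bool) × (ℕ → ℕ)), SigmaOrd ξ B ∧ A' = GameOp B) →
    ∃ φ : (ℕ → Bool) → W, Continuous φ ∧ A' = φ ⁻¹' A

/-- A set `C` is split by closed sets if any two disjoint closed subsets of `C` can be separated
by a partition of `C` into two closed sets. For closed `C` in a normal space this says that `C`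
is zero-dimensional. -/
def ClosedSplits {X : Type*} [TopologicalSpace X] (C : Set X) : Prop :=
  ∀ A B : Set X, IsClosed A → IsClosed B → A ⊆ C → B ⊆ C → Disjoint A B →
    ∃ P Q : Set X, IsClosed P ∧ IsClosed Q ∧ A ⊆ P ∧ B ⊆ Q ∧ Disjoint P Q ∧ P ∪ Q = C

namespace ClosedSplits

variable {X W : Type*} [TopologicalSpace X] [TopologicalSpace W]

theorem mono {C D : Set X} (h : ClosedSplits C) (hD : IsClosed D) (hDC : D ⊆ C) :
    ClosedSplits D := by
  intro A B hA hB hAD hBD hAB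
  obtain ⟨P, Q, hP, hQ, hAP, hBQ, hPQ, hU⟩ :=
    h A B hA hB (hAD.trans hDC) (hBD.trans hDC) hAB
  refine ⟨P ∩ D, Q ∩ D, hP.inter hD, hQ.inter hD, subset_inter hAP hAD, subset_inter hBQ hBD,
    hPQ.mono inter_subset_left inter_subset_left, ?_⟩
  rw [← union_inter_distrib_right, hU, inter_eq_right.2 hDC]

theorem image {f : W → X} (hf : IsClosedEmbedding f) {C : Set W} (h : ClosedSplits C) :
    ClosedSplits (f '' C) := by
  intro A B hA hB hAC hBC hAB
  have key : ∀ S ⊆ f '' C, f ⁻¹' S ⊆ C := fun S hS w hw =>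
    (hf.injective.mem_set_image).1 (hS hw)
  have lift : ∀ S ⊆ f '' C, ∀ P : Set W, f ⁻¹' S ⊆ P → S ⊆ f '' P := by
    intro S hS P hSP x hx
    obtain ⟨w, -, rfl⟩ := hS hx
    exact mem_image_of_mem f (hSP hx)
  obtain ⟨P, Q, hP, hQ, hAP, hBQ, hPQ, hU⟩ := h (f ⁻¹' A) (f ⁻¹' B)
    (hA.preimage hf.continuous) (hB.preimage hf.continuous) (key A hAC) (key B hBC)
    (hAB.preimage f)
  exact ⟨f '' P, f '' Q, hf.isClosedMap _ hP, hf.isClosedMap _ hQ, lift A hAC P hAP,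
    lift B hBC Q hBQ, (disjoint_image_iff hf.injective).2 hPQ, by rw [← image_union, hU]⟩

/-- Two open sets with disjoint closures can be enlarged, keeping the closures disjoint, so as
to cover a given zero-dimensional closed set. -/
theorem exists_open_extension [NormalSpace X] {C G H : Set X} (hC : ClosedSplits C)
    (hCc : IsClosed C) (hGH : Disjoint (closure G) (closure H)) :
    ∃ G' H' : Set X, IsOpen G' ∧ IsOpen H' ∧ Disjoint (closure G') (closure H') ∧
      G ⊆ G' ∧ H ⊆ H' ∧ C ⊆ G' ∪ H' := by
  obtain ⟨P, Q, hP, hQ, hAP, hBQ, hPQ, hU⟩ := hC (C ∩ closure G) (C ∩ closure H)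
    (hCc.inter isClosed_closure) (hCc.inter isClosed_closure) inter_subset_left
    inter_subset_left (hGH.mono inter_subset_right inter_subset_right)
  have hPC : P ⊆ C := hU ▸ subset_union_left
  have hQC : Q ⊆ C := hU ▸ subset_union_right
  have hd : Disjoint (closure G ∪ P) (closure H ∪ Q) := by
    rw [disjoint_union_left, disjoint_union_right, disjoint_union_right]
    refine ⟨⟨hGH, ?_⟩, ?_, hPQ⟩
    · exact disjoint_left.2 fun x hG hx => disjoint_left.1 hPQ (hAP ⟨hQC hx, hG⟩) hx
    · exact disjoint_left.2 fun x hx hH => disjoint_left.1 hPQ hx (hBQ ⟨hPC hx, hH⟩)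
  obtain ⟨G', hG', hGG', hGd⟩ := normal_exists_closure_subset (isClosed_closure.union hP)
    (isClosed_closure.union hQ).isOpen_compl (subset_compl_iff_disjoint_right.2 hd)
  obtain ⟨H', hH', hHH', hHd⟩ := normal_exists_closure_subset (isClosed_closure.union hQ)
    (isClosed_closure (s := G')).isOpen_compl
    (subset_compl_comm.1 hGd)
  refine ⟨G', H', hG', hH', (subset_compl_iff_disjoint_right.1 hHd).symm,
    subset_closure.trans (subset_union_left.trans hGG'),
    subset_closure.trans (subset_union_left.trans hHH'), ?_⟩
  rw [← hU]
  exact union_subset_union (subset_union_right.trans hGG') (subset_union_right.trans hHH')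

/-- The countable closed sum theorem in dimension zero. -/
theorem of_subset_iUnion [NormalSpace X] {D : Set X} (hD : IsClosed D) {C : ℕ → Set X}
    (hCc : ∀ n, IsClosed (C n)) (hC : ∀ n, ClosedSplits (C n)) (hDC : D ⊆ ⋃ n, C n) :
    ClosedSplits D := by
  intro A B hA hB hAD hBD hAB
  obtain ⟨G₀, hG₀, hAG, hGd⟩ := normal_exists_closure_subset hA hB.isOpen_compl
    (subset_compl_iff_disjoint_right.2 hAB)
  obtain ⟨H₀, hH₀, hBH, hHd⟩ := normal_exists_closure_subset hB
    (isClosed_closure (s := G₀)).isOpen_compl (subset_compl_comm.1 hGd)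
  let S := {p : Set X × Set X //
    IsOpen p.1 ∧ IsOpen p.2 ∧ Disjoint (closure p.1) (closure p.2)}
  have step : ∀ (n : ℕ) (p : S), ∃ q : S, p.1.1 ⊆ q.1.1 ∧ p.1.2 ⊆ q.1.2 ∧
      C n ⊆ q.1.1 ∪ q.1.2 := by
    intro n p
    obtain ⟨G', H', hG', hH', hd, hG, hH, hc⟩ :=
      (hC n).exists_open_extension (hCc n) p.2.2.2
    exact ⟨⟨(G', H'), hG', hH', hd⟩, hG, hH, hc⟩
  choose next h₁ h₂ h₃ using step
  let s : ℕ → S := fun n => Nat.rec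
    ⟨(G₀, H₀), hG₀, hH₀, (subset_compl_iff_disjoint_right.1 hHd).symm⟩ next n
  have hs : ∀ n, s (n + 1) = next n (s n) := fun n => rfl
  have m₁ : Monotone fun n => (s n).1.1 := monotone_nat_of_le_succ fun n => by
    rw [hs]; exact h₁ n (s n)
  have m₂ : Monotone fun n => (s n).1.2 := monotone_nat_of_le_succ fun n => by
    rw [hs]; exact h₂ n (s n)
  have hcov : D ⊆ (⋃ n, (s n).1.1) ∪ ⋃ n, (s n).1.2 := by
    intro x hx
    obtain ⟨n, hn⟩ := mem_iUnion.1 (hDC hx)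
    rcases h₃ n (s n) hn with h | h
    · exact Or.inl (mem_iUnion.2 ⟨n + 1, h⟩)
    · exact Or.inr (mem_iUnion.2 ⟨n + 1, h⟩)
  have hdisj : Disjoint (⋃ n, (s n).1.1) (⋃ n, (s n).1.2) := by
    refine disjoint_iUnion_left.2 fun i => disjoint_iUnion_right.2 fun j => ?_
    exact ((s (max i j)).2.2.2.mono subset_closure subset_closure).mono
      (m₁ (le_max_left _ _)) (m₂ (le_max_right _ _))
  have hAs : A ⊆ ⋃ n, (s n).1.1 := hAG.trans (subset_iUnion (fun n => (s n).1.1) 0)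
  have hBs : B ⊆ ⋃ n, (s n).1.2 := hBH.trans (subset_iUnion (fun n => (s n).1.2) 0)
  refine ⟨D \ ⋃ n, (s n).1.2, D \ ⋃ n, (s n).1.1,
    hD.sdiff (isOpen_iUnion fun n => (s n).2.2.1), hD.sdiff (isOpen_iUnion fun n => (s n).2.1),
    subset_sdiff.2 ⟨hAD, hdisj.mono_left hAs⟩, subset_sdiff.2 ⟨hBD, hdisj.symm.mono_left hBs⟩,
    ?_, ?_⟩
  · refine disjoint_left.2 fun x hx hx' => ?_
    rcases hcov hx.1 with h | h
    exacts [hx'.2 h, hx.2 h]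
  · refine Subset.antisymm (union_subset sdiff_subset sdiff_subset) fun x hx => ?_
    by_cases h : x ∈ ⋃ n, (s n).1.2
    · exact Or.inr ⟨hx, fun h' => disjoint_left.1 hdisj h' h⟩
    · exact Or.inl ⟨hx, h⟩

theorem range_of_dimLE_zero {f : W → X} (hf : IsClosedEmbedding f) (h : DimLE W 0) :
    ClosedSplits (range f) := by
  intro A B hA hB hAr hBr hAB
  obtain ⟨V, hVo, hVU, hVc, hV⟩ := h 2 ![(f ⁻¹' A)ᶜ, (f ⁻¹' B)ᶜ]
    (by
      intro i
      fin_cases i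
      · exact (hA.preimage hf.continuous).isOpen_compl
      · exact (hB.preimage hf.continuous).isOpen_compl)
    (by
      refine eq_univ_of_forall fun w => mem_iUnion.2 ?_
      by_cases hw : f w ∈ A
      · exact ⟨1, fun hw' => disjoint_left.1 hAB hw hw'⟩
      · exact ⟨0, hw⟩)
  have hcov : ∀ w, w ∈ V 0 ∨ w ∈ V 1 := by
    intro w
    have := hVc.ge (mem_univ w)
    simpa [Fin.exists_fin_two] using this
  have hdisj : ∀ w, w ∈ V 0 → w ∉ V 1 := by
    intro w h0 h1
    have := (Set.ncard_le_one (toFinite _)).1 (hV w) 0 h0 1 h1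
    exact absurd this (by decide)
  have e0 : (V 0)ᶜ = V 1 := by
    ext w
    exact ⟨fun h => (hcov w).resolve_left h, fun h h' => hdisj w h' h⟩
  have c1 : IsClosed (V 1) := e0 ▸ (hVo 0).isClosed_compl
  have c0 : IsClosed (V 0) := by
    rw [← compl_compl (V 0), e0]
    exact (hVo 1).isClosed_compl
  refine ⟨f '' V 1, f '' V 0, hf.isClosedMap _ c1, hf.isClosedMap _ c0, ?_, ?_, ?_, ?_⟩
  · intro x hx
    obtain ⟨w, rfl⟩ := hAr hx
    exact mem_image_of_mem f ((hcov w).resolve_left fun hw => hVU 0 hw hx)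
  · intro x hx
    obtain ⟨w, rfl⟩ := hBr hx
    exact mem_image_of_mem f ((hcov w).resolve_right fun hw => hVU 1 hw hx)
  · exact (disjoint_image_iff hf.injective).2 (disjoint_left.2 fun w h1 h0 => hdisj w h0 h1)
  · rw [← image_union, ← e0, compl_union_self, image_univ]

theorem dimLE_zero_of_range [NormalSpace W] {f : W → X} (hf : IsClosedEmbedding f)
    (h : ClosedSplits (range f)) : DimLE W 0 := by
  intro k U hUo hUc
  obtain ⟨F, hFc, hF, hFU⟩ := exists_iUnion_eq_closed_subset hUo (fun x => toFinite _) hUc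
  have sep : ∀ i, ∃ C : Set W, IsClopen C ∧ F i ⊆ C ∧ C ⊆ U i := by
    intro i
    obtain ⟨P, Q, hP, hQ, hAP, hBQ, hPQ, hu⟩ := h (f '' F i) (f '' (U i)ᶜ)
      (hf.isClosedMap _ (hF i)) (hf.isClosedMap _ (hUo i).isClosed_compl)
      (image_subset_range _ _) (image_subset_range _ _)
      ((disjoint_image_iff hf.injective).2
        (disjoint_compl_right_iff_subset.2 (hFU i)))
    have e : (f ⁻¹' Q)ᶜ = f ⁻¹' P := by
      ext w
      refine ⟨fun hw => ?_, fun hw hw' => disjoint_left.1 hPQ hw hw'⟩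
      exact (hu.ge (mem_range_self w) : f w ∈ P ∪ Q).resolve_right hw
    refine ⟨f ⁻¹' P, ⟨hP.preimage hf.continuous, ?_⟩, image_subset_iff.1 hAP, fun w hw => ?_⟩
    · rw [← e]
      exact (hQ.preimage hf.continuous).isOpen_compl
    · by_contra hw'
      exact disjoint_left.1 hPQ hw (hBQ (mem_image_of_mem f hw'))
  choose C hC hFC hCU using sep
  refine ⟨fun i => C i \ ⋃ j ∈ Iio i, C j, fun i => (hC i).isOpen.sdiff ?_,
    fun i => sdiff_subset.trans (hCU i), ?_, ?_⟩
  · exact (toFinite (Iio i)).isClosed_biUnion fun j _ => (hC j).isClosed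
  · refine eq_univ_of_forall fun x => mem_iUnion.2 ?_
    have hne : {i | x ∈ C i}.Nonempty := by
      obtain ⟨i, hi⟩ := mem_iUnion.1 (hFc.ge (mem_univ x))
      exact ⟨i, hFC i hi⟩
    obtain ⟨i, hi, hmin⟩ := wellFounded_lt.has_min {i | x ∈ C i} hne
    refine ⟨i, hi, ?_⟩
    simp only [mem_iUnion, not_exists]
    exact fun j hj hx => hmin j hx hj
  · intro x
    refine (Set.ncard_le_one (toFinite _)).2 ?_
    have aux : ∀ i j, x ∈ C i → (x ∉ ⋃ l ∈ Iio j, C l) → ¬ i < j := fun i j hi hj hij =>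
      hj (mem_biUnion (mem_Iio.2 hij) hi)
    intro i hi j hj
    exact le_antisymm (not_lt.1 (aux j i hj.1 hi.2)) (not_lt.1 (aux i j hi.1 hj.2))

end ClosedSplits

section FineCovers

variable {W : Type*} [MetricSpace W]

/-- The compact sets which can be covered by disjoint open sets of diameter less than `δ`. -/
def finelySeparated (W : Type*) [MetricSpace W] (δ : ℝ) : Set (NonemptyCompacts W) :=
  {L | ∃ 𝒱 : Set (Set W), (∀ V ∈ 𝒱, IsOpen V ∧ ∀ x ∈ V, ∀ y ∈ V, dist x y < δ) ∧
    𝒱.PairwiseDisjoint id ∧ (L : Set W) ⊆ ⋃₀ 𝒱}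

theorem isOpen_finelySeparated (δ : ℝ) : IsOpen (finelySeparated W δ) := by
  refine isOpen_iff_forall_mem_open.2 fun L ⟨𝒱, h𝒱, hd, hL⟩ => ?_
  exact ⟨{K | (K : Set W) ⊆ ⋃₀ 𝒱}, fun K hK => ⟨𝒱, h𝒱, hd, hK⟩,
    NonemptyCompacts.isOpen_subsets_of_isOpen (isOpen_sUnion fun V hV => (h𝒱 V hV).1), hL⟩

theorem dense_finelySeparated {δ : ℝ} (hδ : 0 < δ) : Dense (finelySeparated W δ) := by
  refine NonemptyCompacts.dense_setOfPred_finite.mono fun L hL => ?_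
  obtain ⟨U, hU, hd⟩ := Set.Finite.t2_separation hL
  refine ⟨(fun x => U x ∩ Metric.ball x (δ / 2)) '' L, ?_, ?_, ?_⟩
  · rintro _ ⟨x, -, rfl⟩
    refine ⟨(hU x).2.inter Metric.isOpen_ball, fun y hy z hz => ?_⟩
    have h₁ := Metric.mem_ball.1 hy.2
    have h₂ := Metric.mem_ball.1 hz.2
    linarith [dist_triangle_right y z x]
  · rintro _ ⟨x, hx, rfl⟩ _ ⟨y, hy, rfl⟩ hne
    have hxy : x ≠ y := fun h => hne (by rw [h])
    exact (hd hx hy hxy).mono inter_subset_left inter_subset_left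
  · exact fun x hx => ⟨_, mem_image_of_mem _ hx, (hU x).1, Metric.mem_ball_self (half_pos hδ)⟩

theorem closedSplits_of_forall_finelySeparated {L : NonemptyCompacts W}
    (hL : ∀ n : ℕ, L ∈ finelySeparated W (1 / (n + 1))) : ClosedSplits (L : Set W) := by
  intro A B hA hB hAL hBL hAB
  obtain ⟨δ, hδ, hsep⟩ : ∃ δ > 0, ∀ a ∈ A, ∀ b ∈ B, δ ≤ dist a b := by
    obtain ⟨δ, hδ, h⟩ := hAB.exists_thickenings (L.isCompact.of_isClosed_subset hA hAL) hB
    refine ⟨δ, hδ, fun a ha b hb => ?_⟩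
    by_contra! hlt
    exact disjoint_left.1 h (Metric.mem_thickening_iff.2 ⟨a, ha, by rwa [dist_comm]⟩)
      (Metric.self_subset_thickening hδ B hb)
  obtain ⟨n, hn⟩ := exists_nat_one_div_lt hδ
  obtain ⟨𝒱, h𝒱, hd, hc⟩ := hL n
  let G := ⋃₀ {V ∈ 𝒱 | (V ∩ A).Nonempty}
  let H := ⋃₀ {V ∈ 𝒱 | ¬ (V ∩ A).Nonempty}
  have hG : IsOpen G := isOpen_sUnion fun V hV => (h𝒱 V hV.1).1
  have hH : IsOpen H := isOpen_sUnion fun V hV => (h𝒱 V hV.1).1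
  have hGH : Disjoint G H := by
    refine disjoint_left.2 ?_
    rintro x ⟨V, hV, hxV⟩ ⟨V', hV', hxV'⟩
    obtain rfl : V = V' := hd.elim hV.1 hV'.1 (not_disjoint_iff.2 ⟨x, hxV, hxV'⟩)
    exact hV'.2 hV.2
  have hcov : (L : Set W) ⊆ G ∪ H := by
    intro x hx
    obtain ⟨V, hV, hxV⟩ := hc hx
    by_cases h : (V ∩ A).Nonempty
    exacts [Or.inl ⟨V, ⟨hV, h⟩, hxV⟩, Or.inr ⟨V, ⟨hV, h⟩, hxV⟩]
  have hLc : IsClosed (L : Set W) := L.isCompact.isClosed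
  refine ⟨L \ H, L \ G, hLc.sdiff hH, hLc.sdiff hG, fun x hx => ⟨hAL hx, ?_⟩,
    fun x hx => ⟨hBL hx, ?_⟩, ?_, ?_⟩
  · rintro ⟨V, hV, hxV⟩
    exact hV.2 ⟨x, hxV, hx⟩
  · rintro ⟨V, hV, hxV⟩
    obtain ⟨a, haV, ha⟩ := hV.2
    exact (((h𝒱 V hV.1).2 a haV x hxV).trans hn).not_ge (hsep a ha x hx)
  · refine disjoint_left.2 fun x hx hx' => ?_
    rcases hcov hx.1 with h | h
    exacts [hx'.2 h, hx.2 h]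
  · refine Subset.antisymm (union_subset sdiff_subset sdiff_subset) fun x hx => ?_
    by_cases h : x ∈ H
    · exact Or.inr ⟨hx, fun h' => disjoint_left.1 hGH h' h⟩
    · exact Or.inl ⟨hx, h⟩

end FineCovers

theorem vietoris_eq (Y : Type*) [TopologicalSpace Y] :
    vietoris Y = TopologicalSpace.vietoris Y := by
  unfold vietoris TopologicalSpace.vietoris
  congr 1
  ext S
  simp only [mem_union, mem_image, mem_ofPred_eq, eq_comm (a := S)]
  rfl

/-- A Vietoris neighbourhood of the closure of `e '' M` contains the closures of `e '' N` for all
`N ⊆ M` containing a suitable finite set. -/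
theorem exists_finite_forall_closure_image_mem {W Y : Type*} [TopologicalSpace Y] (e : W → Y)
    (M : Set W) {O : Set (Set Y)} (hO : IsOpen[vietoris Y] O) (hM : closure (e '' M) ∈ O) :
    ∃ S : Set W, S.Finite ∧ S ⊆ M ∧ ∀ N, S ⊆ N → N ⊆ M → closure (e '' N) ∈ O := by
  induction hO with
  | basic O hO =>
    rcases hO with ⟨U, hU, rfl⟩ | ⟨U, hU, rfl⟩
    · exact ⟨∅, finite_empty, empty_subset _, fun N _ hN =>
        (closure_mono (image_mono hN)).trans hM⟩
    · obtain ⟨y, hy, hyU⟩ := hM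
      obtain ⟨_, hzU, x, hx, rfl⟩ := mem_closure_iff.1 hy U hU hyU
      exact ⟨{x}, finite_singleton x, singleton_subset_iff.2 hx, fun N hN _ =>
        ⟨e x, subset_closure (mem_image_of_mem e (hN rfl)), hzU⟩⟩
  | univ => exact ⟨∅, finite_empty, empty_subset _, fun _ _ _ => mem_univ _⟩
  | inter O₁ O₂ _ _ ih₁ ih₂ =>
    obtain ⟨S₁, hf₁, hS₁, h₁⟩ := ih₁ hM.1
    obtain ⟨S₂, hf₂, hS₂, h₂⟩ := ih₂ hM.2
    exact ⟨S₁ ∪ S₂, hf₁.union hf₂, union_subset hS₁ hS₂, fun N hN hNM =>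
      ⟨h₁ N (subset_union_left.trans hN) hNM, h₂ N (subset_union_right.trans hN) hNM⟩⟩
  | sUnion 𝒪 _ ih =>
    obtain ⟨O, hO, hMO⟩ := hM
    obtain ⟨S, hf, hS, h⟩ := ih O hO hMO
    exact ⟨S, hf, hS, fun N hN hNM => ⟨O, hO, h N hN hNM⟩⟩

/-- If `F₀(X)` is `F_σ`, then every nonempty completely metrizable closed subspace of `X` contains
a zero-dimensional ball. -/
theorem exists_closedSplits_image_closedBall {X W : Type*} [TopologicalSpace X] [MetricSpace W]
    [CompleteSpace W] [Nonempty W] {g : W → X} (hg : IsClosedEmbedding g)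
    [∀ F : Cl X, NormalSpace F.1] {τ : TopologicalSpace (Cl X)} (hτ : IsAdmissible X τ)
    {F : ℕ → Set (Cl X)} (hF : ∀ n, IsClosed[τ] (F n)) (hF0 : F0 X = ⋃ n, F n) :
    ∃ (w : W) (r : ℝ), 0 < r ∧ ClosedSplits (g '' Metric.closedBall w r) := by
  obtain ⟨Y, _, _, _, e, he, rfl⟩ := hτ
  let φ : {M : Set W // IsClosed M} → Cl X := fun M => ⟨g '' M.1, hg.isClosedMap _ M.2⟩
  let ψ : NonemptyCompacts W → Cl X := fun L => φ ⟨L, L.isCompact.isClosed⟩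
  have hψ : @Continuous _ _ _ ((vietoris Y).induced fun F : Cl X => closure (e '' F.1)) ψ := by
    rw [continuous_induced_rng, vietoris_eq]
    have hc : Continuous (e ∘ g) := he.continuous.comp hg.continuous
    let _ : TopologicalSpace (Set W) := TopologicalSpace.vietoris W
    let _ : TopologicalSpace (Set Y) := TopologicalSpace.vietoris Y
    convert hc.image_vietoris.comp NonemptyCompacts.continuous_coe using 1
    funext L
    change closure (e '' (g '' L)) = (e ∘ g) '' L
    rw [← image_comp]
    exact (L.isCompact.image hc).isClosed.closure_eq
  have hT : ∀ n, IsClosed (ψ ⁻¹' F n) := fun n =>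
    @IsClosed.preimage _ _ _ ((vietoris Y).induced fun F : Cl X => closure (e '' F.1))
      _ hψ _ (hF n)
  have hGδ : IsGδ (⋂ n : ℕ, finelySeparated W (1 / (n + 1))) :=
    .iInter_of_isOpen fun n => isOpen_finelySeparated _
  have hdense : Dense (⋂ n : ℕ, finelySeparated W (1 / (n + 1))) :=
    dense_iInter_of_isOpen (fun n => isOpen_finelySeparated _)
      fun n => dense_finelySeparated Nat.one_div_pos_of_nat
  have hsub : (⋂ n : ℕ, finelySeparated W (1 / (n + 1))) ⊆ ⋃ n, ψ ⁻¹' F n := by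
    intro L hL
    rw [← preimage_iUnion, ← hF0]
    refine ClosedSplits.dimLE_zero_of_range (ψ L).2.isClosedEmbedding_subtypeVal ?_
    rw [Subtype.range_coe]
    exact (closedSplits_of_forall_finelySeparated (mem_iInter.1 hL)).image hg
  obtain ⟨L, hL⟩ := (hGδ.dense_iUnion_interior_of_closed hdense hT hsub).nonempty
  obtain ⟨n, hn⟩ := mem_iUnion.1 hL
  obtain ⟨ε, hε, hball⟩ := Metric.mem_nhds_iff.1 (mem_interior_iff_mem_nhds.1 hn)
  obtain ⟨x, hx⟩ := L.nonempty
  refine ⟨x, ε / 2, half_pos hε, ?_⟩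
  have hMc : IsClosed ((L : Set W) ∪ Metric.closedBall x (ε / 2)) :=
    L.isCompact.isClosed.union Metric.isClosed_closedBall
  have hmem : φ ⟨_, hMc⟩ ∈ F n := by
    by_contra hnot
    obtain ⟨O, hO, hOF⟩ := (hF n).isOpen_compl
    have hiff : ∀ M, φ M ∉ F n ↔ closure ((e ∘ g) '' M.1) ∈ O := by
      intro M
      rw [image_comp]
      exact (Set.ext_iff.1 hOF (φ M)).symm
    obtain ⟨S, hSf, hSM, hS⟩ :=
      exists_finite_forall_closure_image_mem (e ∘ g) _ hO ((hiff ⟨_, hMc⟩).1 hnot)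
    let L' : NonemptyCompacts W := ⟨⟨L ∪ S, L.isCompact.union hSf.isCompact⟩, ⟨x, Or.inl hx⟩⟩
    refine (hiff ⟨L', L'.isCompact.isClosed⟩).2
      (hS _ subset_union_right (union_subset subset_union_left hSM)) (hball ?_)
    rw [Metric.mem_ball, Metric.NonemptyCompacts.dist_eq]
    refine (Metric.hausdorffDist_le_of_mem_dist (half_pos hε).le ?_ ?_).trans_lt
      (half_lt_self hε)
    · rintro y (hy | hy)
      · exact ⟨y, hy, by simpa using (half_pos hε).le⟩
      · rcases hSM hy with hy | hy
        · exact ⟨y, hy, by simpa using (half_pos hε).le⟩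
        · exact ⟨x, hx, hy⟩
    · exact fun y hy => ⟨y, Or.inl hy, by simpa using (half_pos hε).le⟩
  have hdim : φ ⟨_, hMc⟩ ∈ F0 X := hF0 ▸ mem_iUnion.2 ⟨n, hmem⟩
  have hs := ClosedSplits.range_of_dimLE_zero (φ ⟨_, hMc⟩).2.isClosedEmbedding_subtypeVal hdim
  rw [Subtype.range_coe] at hs
  exact hs.mono (hg.isClosedMap _ Metric.isClosed_closedBall) (image_mono subset_union_right)

/-- If `F₀(X)` is an `F_σ` subset of `F(X)` (for an admissible topology), then the Polish space `X`
is zero-dimensional. -/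
theorem closedSplits_univ_of_F0_Fsigma {X : Type*} [TopologicalSpace X] [PolishSpace X]
    {τ : TopologicalSpace (Cl X)} (hτ : IsAdmissible X τ)
    {F : ℕ → Set (Cl X)} (hF : ∀ n, IsClosed[τ] (F n)) (hF0 : F0 X = ⋃ n, F n) :
    ClosedSplits (univ : Set X) := by
  let _ := upgradeIsCompletelyMetrizable X
  obtain ⟨T, hTc, hTs, hTU⟩ := isOpen_sUnion_countable
    {U : Set X | IsOpen U ∧ ClosedSplits (closure U)} fun U hU => hU.1
  have hempty : ClosedSplits (closure (∅ : Set X)) := by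
    rw [closure_empty]
    intro A B hA hB hA' hB' hAB
    exact ⟨∅, ∅, isClosed_empty, isClosed_empty, hA', hB', disjoint_bot_left, union_self _⟩
  obtain ⟨u, hu⟩ : ∃ u : ℕ → Set X, insert ∅ T = range u :=
    (hTc.insert ∅).exists_eq_range (insert_nonempty _ _)
  have huS : ∀ n, ClosedSplits (closure (u n)) := by
    intro n
    rcases hu.ge (mem_range_self n) with h | h
    · rwa [h]
    · exact (hTs h).2
  have hTu : ⋃₀ T ⊆ ⋃ n, closure (u n) := by
    rintro x ⟨V, hV, hxV⟩
    obtain ⟨n, rfl⟩ := hu.le (mem_insert_of_mem _ hV)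
    exact mem_iUnion.2 ⟨n, subset_closure hxV⟩
  rcases (⋃₀ T)ᶜ.eq_empty_or_nonempty with hK | hK
  · exact .of_subset_iUnion isClosed_univ (fun n => isClosed_closure) huS
      ((compl_empty_iff.1 hK).ge.trans hTu)
  have hKc : IsClosed (⋃₀ T)ᶜ := (isOpen_sUnion fun U hU => (hTs hU).1).isClosed_compl
  have : Nonempty ↥(⋃₀ T)ᶜ := hK.to_subtype
  have : CompleteSpace ↥(⋃₀ T)ᶜ := hKc.completeSpace_coe
  obtain ⟨x, r, hr, hx⟩ :=
    exists_closedSplits_image_closedBall hKc.isClosedEmbedding_subtypeVal hτ hF hF0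
  have hball : ClosedSplits (closure (Metric.ball (x : X) r)) := by
    refine .of_subset_iUnion isClosed_closure (C := fun n => Nat.casesOn n
      (Subtype.val '' Metric.closedBall x r) fun m => closure (u m)) ?_ ?_ ?_
    · rintro (_ | m)
      · exact hKc.isClosedMap_subtype_val _ Metric.isClosed_closedBall
      · exact isClosed_closure
    · rintro (_ | m)
      exacts [hx, huS m]
    · intro y hy
      by_cases hyT : y ∈ ⋃₀ T
      · obtain ⟨m, hm⟩ := mem_iUnion.1 (hTu hyT)
        exact mem_iUnion.2 ⟨m + 1, hm⟩
      · exact mem_iUnion.2 ⟨0, ⟨y, hyT⟩,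
          Metric.closure_ball_subset_closedBall (x := (x : X)) hy, rfl⟩
  exact absurd (hTU.ge ⟨_, ⟨Metric.isOpen_ball, hball⟩, Metric.mem_ball_self hr⟩) x.2

/-- If `X` is a Polish space and `F₀(X)` is an `F_σ` subset of `F(X)` (for an admissible
topology), then `X` is zero-dimensional, and hence `F₀(X) = F(X)`. -/
theorem zeroDim_of_F0_Fsigma {X : Type*} [TopologicalSpace X] [PolishSpace X]
    (τ : TopologicalSpace (Cl X)) (hτ : IsAdmissible X τ)
    (h : ∃ F : ℕ → Set (Cl X), (∀ n, @IsClosed _ τ (F n)) ∧ F0 X = ⋃ n, F n) :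
    DimLE X 0 ∧ F0 X = Set.univ := by
  obtain ⟨F, hF, hF0⟩ := h
  have hX := closedSplits_univ_of_F0_Fsigma hτ hF hF0
  let _ := upgradeIsCompletelyMetrizable X
  refine ⟨ClosedSplits.dimLE_zero_of_range IsClosedEmbedding.id (range_id ▸ hX),
    eq_univ_of_forall fun C =>
      ClosedSplits.dimLE_zero_of_range C.2.isClosedEmbedding_subtypeVal ?_⟩
  rw [Subtype.range_coe]
  exact hX.mono C.2 (subset_univ _)
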